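/- Let ι : S×P → S×P be defined by ι(g,[v]) = (g, g·[v]). Then the map η ↦ ι_*(ν×η) sends the set of ν-stationary Borel probability measures on P bijectively onto the set of Q_ν-invariant Borel probability measures on S×P, and its inverse is λ ↦ π_*λ, where π : S×P → P is the canonical projection π(g,[v]) = [v]. -/

import Mathlib

open MeasureTheory Filter Topology
open scoped ENNReal

noncomputable section

abbrev Euc (d : ℕ) := EuclideanSpace ℝ (Fin d)
abbrev Md (d : ℕ) := Euc d →L[ℝ] Euc d

/-- The group `G = GL(d,ℝ)`, realized as the group of units of the algebra of linear
endomorphisms of `ℝ^d`. -/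
abbrev GLd (d : ℕ) := (Md d)ˣ

/-- The real projective space `P = P(ℝ^d)`. -/
abbrev Pd (d : ℕ) := Projectivization ℝ (Euc d)

instance (d : ℕ) : TopologicalSpace (Pd d) :=
  inferInstanceAs (TopologicalSpace (Quotient (projectivizationSetoid ℝ (Euc d))))

instance (d : ℕ) : MeasurableSpace (Pd d) := borel _

/-- The projective action of `GL(d,ℝ)` on `P(ℝ^d)`: `g • [v] = [g v]`. -/
def pact {d : ℕ} (g : GLd d) (x : Pd d) : Pd d :=
  Projectivization.map ((g : Md d) : Euc d →ₗ[ℝ] Euc d)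
    (by
      have h : Function.LeftInverse (⇑((g⁻¹ : GLd d) : Md d)) (⇑((g : GLd d) : Md d)) := by
        intro v
        have h1 : ((g⁻¹ : GLd d) : Md d) * ((g : GLd d) : Md d) = 1 := g.inv_mul
        calc ((g⁻¹ : GLd d) : Md d) (((g : GLd d) : Md d) v)
            = (((g⁻¹ : GLd d) : Md d) * ((g : GLd d) : Md d)) v := rfl
          _ = v := by rw [h1]; rfl
      exact h.injective) x

/-- The (topological) support of a measure. -/
def msupport {α : Type*} [TopologicalSpace α] [MeasurableSpace α] (μ : Measure α) : Set α :=
  {x | ∀ u : Set α, IsOpen u → x ∈ u → 0 < μ u}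

/-- The measure `ν`, viewed as a measure on its (compact) support `S`. -/
def nuS {d : ℕ} (ν : Measure (GLd d)) : Measure (↥(msupport ν)) :=
  ν.comap Subtype.val

/-- The operator `Q_ν` on functions on `S × P`:
`(Q_ν ψ)(g′, x) = ∫_S ψ(g, g • x) dν(g)` (the value does not depend on `g′`). -/
def Qop {d : ℕ} (ν : Measure (GLd d)) (ψ : ↥(msupport ν) × Pd d → ℝ) :
    ↥(msupport ν) × Pd d → ℝ :=
  fun p => ∫ g : ↥(msupport ν), ψ (g, pact (g : GLd d) p.2) ∂(nuS ν)

/-- A Borel probability measure `lam` on `S × P` is `Q_ν`-invariant if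
`∫ Q_ν ψ dlam = ∫ ψ dlam` for every continuous (bounded) `ψ`. -/
def QInv {d : ℕ} (ν : Measure (GLd d)) (lam : Measure (↥(msupport ν) × Pd d)) : Prop :=
  ∀ ψ : BoundedContinuousFunction (↥(msupport ν) × Pd d) ℝ,
    ∫ p, Qop ν (⇑ψ) p ∂lam = ∫ p, ψ p ∂lam

/-- `Σ(ν,φ) = sup { ∫ φ dlam : lam a Q_ν-invariant Borel probability measure on S × P }`. -/
def SigmaSup {d : ℕ} (ν : Measure (GLd d))
    (φ : BoundedContinuousFunction (↥(msupport ν) × Pd d) ℝ) : ℝ :=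
  sSup {r : ℝ | ∃ lam : Measure (↥(msupport ν) × Pd d),
    IsProbabilityMeasure lam ∧ QInv ν lam ∧ r = ∫ p, φ p ∂lam}


/-- A Borel probability measure `η` on `P` is `ν`-stationary if
`∫ ψ dη = ∫∫ ψ(g • x) dν(g) dη(x)` for every bounded measurable `ψ`. -/
def Stationary {d : ℕ} (ν : Measure (GLd d)) (η : Measure (Pd d)) : Prop :=
  ∀ ψ : Pd d → ℝ, Measurable ψ → (∃ C, ∀ x, |ψ x| ≤ C) →
    ∫ x, ψ x ∂η = ∫ p : GLd d × Pd d, ψ (pact p.1 p.2) ∂(ν.prod η)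

/-- The map `ι : S × P → S × P`, `ι(g,[v]) = (g, g • [v])`. -/
def iotaMap {d : ℕ} (ν : Measure (GLd d)) :
    ↥(msupport ν) × Pd d → ↥(msupport ν) × Pd d :=
  fun p => (p.1, pact (p.1 : GLd d) p.2)

lemma continuous_rankOne_self {E : Type*} [NormedAddCommGroup E] [InnerProductSpace ℝ E] :
    Continuous fun v : E => InnerProductSpace.rankOne ℝ v v :=
  (InnerProductSpace.rankOne ℝ (E := E) (F := E)).continuous₂.comp
    (continuous_id.prodMk continuous_id)

section ProjectiveTopology

variable {d : ℕ}

lemma continuous_projectivization_mk' :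
    Continuous (Projectivization.mk' ℝ : {v : Euc d // v ≠ 0} → Pd d) :=
  continuous_quotient_mk'

/-- The projection `ℝ^d ∖ {0} → P(ℝ^d)` is an open quotient map. -/
lemma isOpenQuotientMap_projectivization_mk' :
    IsOpenQuotientMap (Projectivization.mk' ℝ : {v : Euc d // v ≠ 0} → Pd d) where
  surjective := Quotient.mk''_surjective
  continuous := continuous_projectivization_mk'
  isOpenMap := by
    intro U hU
    have hq : Topology.IsQuotientMap
        (Projectivization.mk' ℝ : {v : Euc d // v ≠ 0} → Pd d) := isQuotientMap_quotient_mk'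
    rw [← hq.isOpen_preimage]
    have key : (Projectivization.mk' ℝ : {v : Euc d // v ≠ 0} → Pd d) ⁻¹'
        (Projectivization.mk' ℝ '' U) = ⋃ t : ℝˣ, (fun v : {v : Euc d // v ≠ 0} =>
          (⟨t • (v : Euc d), (smul_ne_zero_iff_ne t).2 v.2⟩ : {v : Euc d // v ≠ 0})) ⁻¹' U := by
      ext v
      simp only [Set.mem_preimage, Set.mem_image, Set.mem_iUnion, Projectivization.mk'_eq_mk]
      constructor
      · rintro ⟨w, hw, hwv⟩
        obtain ⟨t, ht⟩ := (Projectivization.mk_eq_mk_iff ℝ _ _ w.2 v.2).1 hwv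
        refine ⟨t, ?_⟩
        convert hw
      · rintro ⟨t, ht⟩
        exact ⟨_, ht, (Projectivization.mk_eq_mk_iff ℝ _ _ _ v.2).2 ⟨t, rfl⟩⟩
    rw [key]
    refine isOpen_iUnion fun t => hU.preimage ?_
    exact Continuous.subtype_mk (continuous_subtype_val.const_smul t) _

instance instCompactSpacePd : CompactSpace (Pd d) := by
  have hc : Continuous fun s : Metric.sphere (0 : Euc d) 1 =>
      (Projectivization.mk' ℝ ⟨(s : Euc d), ne_zero_of_mem_unit_sphere s⟩ : Pd d) :=
    continuous_projectivization_mk'.comp (continuous_subtype_val.subtype_mk _)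
  refine Function.Surjective.compactSpace hc fun x => ?_
  induction x using Projectivization.ind with
  | h v hv =>
    have hn : ‖v‖ ≠ 0 := norm_ne_zero_iff.2 hv
    refine ⟨⟨‖v‖⁻¹ • v, by simp [norm_smul, hn]⟩, ?_⟩
    refine (Projectivization.mk_eq_mk_iff' ℝ _ _ _ hv).2 ?_
    exact ⟨‖v‖⁻¹, rfl⟩

/-- The orthogonal projection onto the line `[v]`, as a map from `P(ℝ^d)` to endomorphisms. -/
def lineProjection : Pd d → Md d :=
  Projectivization.lift
    (fun v => (‖(v : Euc d)‖ ^ 2)⁻¹ • InnerProductSpace.rankOne ℝ (v : Euc d) (v : Euc d)) (by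
      intro a b t h
      have ha := norm_ne_zero_iff.2 a.2
      have ht : t ≠ 0 := by
        rintro rfl
        exact a.2 (by simpa using h)
      have hb := norm_ne_zero_iff.2 b.2
      ext1 x
      simp only [h, _root_.smul_apply, InnerProductSpace.rankOne_apply,
        norm_smul, inner_smul_left, smul_smul, Real.norm_eq_abs, mul_pow, sq_abs]
      congr 1
      simp
      field_simp)

lemma continuous_lineProjection : Continuous (lineProjection (d := d)) := by
  rw [isOpenQuotientMap_projectivization_mk'.isQuotientMap.continuous_iff]
  change Continuous fun v : {v : Euc d // v ≠ 0} =>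
    (‖(v : Euc d)‖ ^ 2)⁻¹ • InnerProductSpace.rankOne ℝ (v : Euc d) (v : Euc d)
  have h1 : Continuous fun v : {v : Euc d // v ≠ 0} => (‖(v : Euc d)‖ ^ 2)⁻¹ :=
    Continuous.inv₀ (by fun_prop) fun v => pow_ne_zero _ (norm_ne_zero_iff.2 v.2)
  have h2 : Continuous fun v : {v : Euc d // v ≠ 0} =>
      InnerProductSpace.rankOne ℝ (v : Euc d) (v : Euc d) :=
    continuous_rankOne_self.comp continuous_subtype_val
  exact h1.smul h2

lemma lineProjection_injective : Function.Injective (lineProjection (d := d)) := by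
  intro x y h
  induction x using Projectivization.ind with
  | h v hv =>
  induction y using Projectivization.ind with
  | h w hw =>
  have hn : ‖v‖ ≠ 0 := norm_ne_zero_iff.2 hv
  have h1 : (‖v‖ ^ 2)⁻¹ • InnerProductSpace.rankOne ℝ v v
      = (‖w‖ ^ 2)⁻¹ • InnerProductSpace.rankOne ℝ w w := h
  have h2 := DFunLike.congr_fun h1 v
  simp only [_root_.smul_apply, InnerProductSpace.rankOne_apply, smul_smul,
    real_inner_self_eq_norm_sq] at h2
  rw [inv_mul_cancel₀ (pow_ne_zero 2 hn), one_smul] at h2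
  rw [Projectivization.mk_eq_mk_iff']
  exact ⟨_, h2.symm⟩

lemma isClosedEmbedding_lineProjection :
    Topology.IsClosedEmbedding (lineProjection (d := d)) :=
  continuous_lineProjection.isClosedEmbedding lineProjection_injective

instance instMetrizableSpacePd : TopologicalSpace.MetrizableSpace (Pd d) :=
  isClosedEmbedding_lineProjection.isEmbedding.metrizableSpace

instance instSecondCountablePd : SecondCountableTopology (Pd d) :=
  isClosedEmbedding_lineProjection.isEmbedding.secondCountableTopology

instance instBorelSpacePd : BorelSpace (Pd d) := ⟨rfl⟩

instance instMetrizableSpaceGLd : TopologicalSpace.MetrizableSpace (GLd d) :=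
  (Units.isOpenEmbedding_val (R := Md d)).isEmbedding.metrizableSpace

instance instSecondCountableGLd : SecondCountableTopology (GLd d) :=
  (Units.isOpenEmbedding_val (R := Md d)).isEmbedding.secondCountableTopology

instance instBorelSpaceGLd : BorelSpace (GLd d) := by
  constructor
  rw [(Units.isOpenEmbedding_val (R := Md d)).isEmbedding.eq_induced, borel_comap,
    ← BorelSpace.measurable_eq (α := Md d)]
  rfl

/-- The projective action `GL(d,ℝ) × P(ℝ^d) → P(ℝ^d)` is jointly continuous. -/
lemma continuous_pact : Continuous fun p : GLd d × Pd d => pact p.1 p.2 := by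
  have hq := (IsOpenQuotientMap.id (X := GLd d)).prodMap
    (isOpenQuotientMap_projectivization_mk' (d := d))
  rw [hq.isQuotientMap.continuous_iff]
  have hne : ∀ p : GLd d × {v : Euc d // v ≠ 0}, (p.1 : Md d) (p.2 : Euc d) ≠ 0 := by
    intro p h0
    apply p.2.2
    have h1 : ((p.1⁻¹ : GLd d) : Md d) * (p.1 : Md d) = 1 := p.1.inv_mul
    have h2 := DFunLike.congr_fun h1 (p.2 : Euc d)
    rw [mul_apply_eq_comp, h0, map_zero] at h2
    exact h2.symm
  have hc : Continuous fun p : GLd d × {v : Euc d // v ≠ 0} =>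
      (⟨(p.1 : Md d) (p.2 : Euc d), hne p⟩ : {v : Euc d // v ≠ 0}) := by
    refine Continuous.subtype_mk ?_ _
    exact (Units.continuous_val.comp continuous_fst).clm_apply
      (continuous_subtype_val.comp continuous_snd)
  exact continuous_projectivization_mk'.comp hc

end ProjectiveTopology

section Support

variable {α : Type*} [TopologicalSpace α] [MeasurableSpace α] (μ : Measure α)

lemma isClosed_msupport : IsClosed (msupport μ) := by
  rw [← isOpen_compl_iff, isOpen_iff_forall_mem_open]
  intro x hx
  simp only [msupport, Set.mem_compl_iff, Set.mem_ofPred_eq, not_forall] at hx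
  obtain ⟨u, hu, hxu, h0⟩ := hx
  exact ⟨u, fun y hy hys => h0 (hys u hu hy), hu, hxu⟩

lemma measure_compl_msupport [SecondCountableTopology α] : μ (msupport μ)ᶜ = 0 := by
  refine measure_null_of_locally_null _ fun x hx => ?_
  simp only [msupport, Set.mem_compl_iff, Set.mem_ofPred_eq, not_forall] at hx
  obtain ⟨u, hu, hxu, h0⟩ := hx
  exact ⟨u, mem_nhdsWithin_of_mem_nhds (hu.mem_nhds hxu), by simpa using h0⟩

end Support

section Skew

variable {d : ℕ} (ν : Measure (GLd d))

lemma map_val_nuS : Measure.map Subtype.val (nuS ν) = ν := by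
  rw [nuS, map_comap_subtype_coe (isClosed_msupport ν).measurableSet]
  exact Measure.restrict_eq_self_of_ae_mem (measure_compl_msupport ν)

instance instIsProbabilityMeasureNuS [IsProbabilityMeasure ν] :
    IsProbabilityMeasure (nuS ν) := by
  constructor
  have h := measure_univ (μ := ν)
  rwa [← map_val_nuS ν, Measure.map_apply measurable_subtype_coe MeasurableSet.univ,
    Set.preimage_univ] at h

lemma continuous_iotaMap : Continuous (iotaMap ν) :=
  continuous_fst.prodMk (continuous_pact.comp
    ((continuous_subtype_val.comp continuous_fst).prodMk continuous_snd))

/-- The joint law of the group element and the point under `ν × η` is the image of the joint law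
with the group element viewed in the support of `ν`. -/
lemma prod_eq_map_nuS_prod [IsProbabilityMeasure ν] (η : Measure (Pd d)) [SFinite η] :
    ν.prod η = Measure.map (Prod.map Subtype.val id) ((nuS ν).prod η) := by
  rw [← Measure.map_prod_map _ _ measurable_subtype_coe measurable_id, map_val_nuS,
    Measure.map_id]

/-- The second marginal of `ι_*(ν × η)` is the image of `ν × η` under the action. -/
lemma map_snd_map_iotaMap [IsProbabilityMeasure ν] (η : Measure (Pd d)) [SFinite η] :
    Measure.map Prod.snd (Measure.map (iotaMap ν) ((nuS ν).prod η)) =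
      Measure.map (fun p : GLd d × Pd d => pact p.1 p.2) (ν.prod η) := by
  rw [prod_eq_map_nuS_prod, Measure.map_map measurable_snd (continuous_iotaMap ν).measurable,
    Measure.map_map continuous_pact.measurable (measurable_subtype_coe.prodMap measurable_id)]
  rfl

/-- Stationarity is invariance of the measure under convolution with `ν`. -/
lemma stationary_iff [IsProbabilityMeasure ν] (η : Measure (Pd d)) [IsProbabilityMeasure η] :
    Stationary ν η ↔ Measure.map (fun p : GLd d × Pd d => pact p.1 p.2) (ν.prod η) = η := by
  have hm : Measurable fun p : GLd d × Pd d => pact p.1 p.2 := continuous_pact.measurable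
  constructor
  · intro h
    have := Measure.isProbabilityMeasure_map (μ := ν.prod η) hm.aemeasurable
    refine ext_of_forall_integral_eq_of_IsFiniteMeasure fun f => ?_
    rw [integral_map hm.aemeasurable f.continuous.aestronglyMeasurable]
    exact (h f f.continuous.measurable ⟨‖f‖, f.norm_coe_le_norm⟩).symm
  · intro h ψ hψ _
    rw [← integral_map (f := ψ) hm.aemeasurable hψ.aestronglyMeasurable, h]

/-- Integrating `Q_ν ψ` against `λ` is integrating `ψ` against `ι_*(ν × π_*λ)`. -/
lemma integral_Qop [IsProbabilityMeasure ν] (lam : Measure (↥(msupport ν) × Pd d))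
    [IsProbabilityMeasure lam] (ψ : BoundedContinuousFunction (↥(msupport ν) × Pd d) ℝ) :
    ∫ p, Qop ν (⇑ψ) p ∂lam =
      ∫ p, ψ p ∂(Measure.map (iotaMap ν) ((nuS ν).prod (Measure.map Prod.snd lam))) := by
  have := Measure.isProbabilityMeasure_map (μ := lam) measurable_snd.aemeasurable
  have hi := continuous_iotaMap ν
  have hint : Integrable (fun p => ψ (iotaMap ν p)) ((nuS ν).prod (Measure.map Prod.snd lam)) :=
    (ψ.compContinuous ⟨_, hi⟩).integrable _
  rw [integral_map hi.measurable.aemeasurable ψ.continuous.aestronglyMeasurable,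
    integral_prod_symm _ hint,
    integral_map measurable_snd.aemeasurable hint.integral_prod_right.aestronglyMeasurable]
  rfl

/-- A probability measure is `Q_ν`-invariant iff it equals `ι_*(ν × π_*λ)`. -/
lemma qInv_iff [IsProbabilityMeasure ν] (lam : Measure (↥(msupport ν) × Pd d))
    [IsProbabilityMeasure lam] :
    QInv ν lam ↔
      Measure.map (iotaMap ν) ((nuS ν).prod (Measure.map Prod.snd lam)) = lam := by
  have := Measure.isProbabilityMeasure_map (μ := lam) measurable_snd.aemeasurable
  have := Measure.isProbabilityMeasure_map (μ := (nuS ν).prod (Measure.map Prod.snd lam))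
    (continuous_iotaMap ν).measurable.aemeasurable
  constructor
  · intro h
    refine ext_of_forall_integral_eq_of_IsFiniteMeasure fun f => ?_
    rw [← integral_Qop, h f]
  · intro h ψ
    rw [integral_Qop, h]

end Skew

/-- **Lemma 4.7.** Let `ν` be a compactly supported Borel probability measure on `G = GL(d,ℝ)`
with support `S` and let `ι(g,[v]) = (g, g•[v])`.  Then `η ↦ ι_*(ν × η)` sends the set of
`ν`-stationary Borel probability measures on `P` bijectively onto the set of `Q_ν`-invariant
Borel probability measures on `S × P`, with inverse `λ ↦ π_* λ`, `π(g,[v]) = [v]`. -/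
theorem stmt7 (d : ℕ) (ν : Measure (GLd d)) [IsProbabilityMeasure ν]
    (hcs : IsCompact (msupport ν)) :
    (∀ η : Measure (Pd d), IsProbabilityMeasure η → Stationary ν η →
      (IsProbabilityMeasure (Measure.map (iotaMap ν) ((nuS ν).prod η)) ∧
        QInv ν (Measure.map (iotaMap ν) ((nuS ν).prod η)) ∧
        Measure.map Prod.snd (Measure.map (iotaMap ν) ((nuS ν).prod η)) = η)) ∧
    (∀ lam : Measure (↥(msupport ν) × Pd d), IsProbabilityMeasure lam → QInv ν lam →
      (IsProbabilityMeasure (Measure.map Prod.snd lam) ∧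
        Stationary ν (Measure.map Prod.snd lam) ∧
        Measure.map (iotaMap ν) ((nuS ν).prod (Measure.map Prod.snd lam)) = lam)) := by
  refine ⟨fun η hη hs => ?_, fun lam hlam hq => ?_⟩
  · have hp := Measure.isProbabilityMeasure_map (μ := (nuS ν).prod η)
      (continuous_iotaMap ν).measurable.aemeasurable
    have hsnd := (map_snd_map_iotaMap ν η).trans ((stationary_iff ν η).1 hs)
    exact ⟨hp, (qInv_iff ν _).2 (by rw [hsnd]), hsnd⟩
  · have hp := Measure.isProbabilityMeasure_map (μ := lam) measurable_snd.aemeasurable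
    have h := (qInv_iff ν lam).1 hq
    refine ⟨hp, (stationary_iff ν _).2 ?_, h⟩
    rw [← map_snd_map_iotaMap, h]

end
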